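/- For every initial state s₀ ∈ S, every discount factor λ ∈ [0,1), every collection 𝒟 = (𝒟^i)_{i∈I} of partitions of the set of states, and every collection of cutoff vectors c = (c^i)_{i∈I} with c^i ∈ ℝ^{𝒟^i}, the modified game Γ̂_λ(s₀;𝒟,c) admits an equilibrium in stationary strategies: there exists a stationary strategy profile x such that for every player i and every strategy σ^i ∈ Σ^i one has γ̂^i_λ(s₀,σ^i,x^{-i};𝒟^i,c^i) ≤ γ̂^i_λ(s₀,x;𝒟^i,c^i). -/

import Mathlib

open MeasureTheory Filter Topology
open scoped ENNReal

noncomputable section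

/-- A finite stochastic game: a finite set of players `I`, a finite set of states `S`,
finite nonempty action sets `A i s`, stage payoffs `u` bounded by `1` in absolute value,
and transition probabilities `q`. -/
structure StocGame where
  (I : Type)
  (S : Type)
  (A : I → S → Type)
  [fintypeI : Fintype I]
  [fintypeS : Fintype S]
  [decI : DecidableEq I]
  [decS : DecidableEq S]
  [fintypeA : ∀ i s, Fintype (A i s)]
  [decA : ∀ i s, DecidableEq (A i s)]
  [nonemptyA : ∀ i s, Nonempty (A i s)]
  (u : I → (s : S) → ((j : I) → A j s) → ℝ)
  (u_bdd : ∀ i s a, |u i s a| ≤ 1)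
  (q : (s : S) → ((j : I) → A j s) → S → ℝ)
  (q_nonneg : ∀ s a s', 0 ≤ q s a s')
  (q_sum : ∀ s a, ∑ s', q s a s' = 1)

namespace StocGame

attribute [instance] fintypeI fintypeS decI decS fintypeA decA nonemptyA

/-- A mixed action over a finite set of actions. -/
abbrev Mixed (α : Type) [Fintype α] : Type := {f : α → ℝ // (∀ a, 0 ≤ f a) ∧ ∑ a, f a = 1}

variable {G : StocGame}

/-- Action profiles available at state `s`. -/
abbrev Prof (G : StocGame) (s : G.S) : Type := (j : G.I) → G.A j s

/-- A pair of a state together with an action profile at that state. -/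
abbrev Step (G : StocGame) : Type := Σ s : G.S, G.Prof s

/-- A finite history: a (reversed) list of past (state, action profile) steps,
together with the current state. -/
abbrev Hist (G : StocGame) : Type := List G.Step × G.S

/-- A behavior strategy of player `i`. -/
abbrev BStrat (G : StocGame) (i : G.I) : Type := (h : G.Hist) → Mixed (G.A i h.2)

/-- A (behavior) strategy profile. -/
abbrev Profile (G : StocGame) : Type := (i : G.I) → G.BStrat i

/-- A stationary strategy of player `i`. -/
abbrev Stat (G : StocGame) (i : G.I) : Type := (s : G.S) → Mixed (G.A i s)

/-- A stationary strategy profile. -/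
abbrev StatProf (G : StocGame) : Type := (i : G.I) → G.Stat i

/-- The behavior strategy profile induced by a stationary strategy profile. -/
def toB (x : G.StatProf) : G.Profile := fun i h => x i h.2

/-- The behavior strategy induced by a stationary strategy. -/
def toB1 {i : G.I} (x : G.Stat i) : G.BStrat i := fun h => x h.2

/-- A stationary strategy profile is pure if at every state each player
puts probability `1` on a single action. -/
def IsPureStat (x : G.StatProf) : Prop :=
  ∀ (i : G.I) (s : G.S), ∃ a : G.A i s, ∀ b, (x i s).1 b = if b = a then 1 else 0

/-- The probability, under strategy profile `σ` and initial state `s0`, that the play follows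
the finite history whose (reversed) list of steps is the first argument and whose current
state is the second argument. -/
def probHistAux (s0 : G.S) (σ : G.Profile) : List G.Step → G.S → ℝ
  | [], s => if s = s0 then 1 else 0
  | ⟨s', a⟩ :: rest, s =>
      probHistAux s0 σ rest s' * (∏ i, (σ i (rest, s')).1 (a i)) * G.q s' a s

/-- The probability that the play follows the finite history `h`. -/
def probHist (s0 : G.S) (σ : G.Profile) (h : G.Hist) : ℝ := probHistAux s0 σ h.1 h.2

/-- The expected `lam`-discounted time `t_lam(s0,σ;s,a)` that the play spends at the
state-action pair `st = (s,a)`. -/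
def tStep (lam : ℝ) (s0 : G.S) (σ : G.Profile) (st : G.Step) : ℝ :=
  (1 - lam) *
    ∑' h : G.Hist, (if h.1.head? = some st then lam ^ (h.1.length - 1) * probHist s0 σ h else 0)

/-- The expected `lam`-discounted time that the play spends in the set of states `D`. -/
def tSet (lam : ℝ) (s0 : G.S) (σ : G.Profile) (D : Finset G.S) : ℝ :=
  ∑ st : G.Step, if st.1 ∈ D then tStep lam s0 σ st else 0

/-- The `lam`-discounted (unnormalized) payoff `U^i_lam(s0,σ;D)` that player `i` receives
while the play is in `D`. -/
def UD (lam : ℝ) (s0 : G.S) (σ : G.Profile) (i : G.I) (D : Finset G.S) : ℝ :=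
  ∑ st : G.Step, if st.1 ∈ D then tStep lam s0 σ st * G.u i st.1 st.2 else 0

/-- The `lam`-discounted payoff of player `i`. -/
def payoffD (lam : ℝ) (s0 : G.S) (σ : G.Profile) (i : G.I) : ℝ :=
  ∑ st : G.Step, tStep lam s0 σ st * G.u i st.1 st.2

/-- `Di` is a partition of the set of states. -/
def IsPartitionF (Di : Finset (Finset G.S)) : Prop :=
  ∀ s : G.S, ∃! D : Finset G.S, D ∈ Di ∧ s ∈ D

/-- The payoff of player `i` in the modified game, given the partition `Di` and
the cutoffs `c`. -/
def modPayoff (lam : ℝ) (s0 : G.S) (σ : G.Profile) (i : G.I)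
    (Di : Finset (Finset G.S)) (c : Finset G.S → ℝ) : ℝ :=
  ∑ D ∈ Di, min (UD lam s0 σ i D) (tSet lam s0 σ D * c D)

/-- The `lam`-discounted min-max value of player `i` in the original game. -/
def minmaxOrig (G : StocGame) (lam : ℝ) (s0 : G.S) (i : G.I) : ℝ :=
  ⨅ σ : G.Profile, ⨆ σi : G.BStrat i, payoffD lam s0 (Function.update σ i σi) i

/-- The `lam`-discounted max-min value of player `i` in the original game. -/
def maxminOrig (G : StocGame) (lam : ℝ) (s0 : G.S) (i : G.I) : ℝ :=
  ⨆ σi : G.BStrat i, ⨅ σ : G.Profile, payoffD lam s0 (Function.update σ i σi) i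

/-- The min-max value of player `i` in the modified game. -/
def minmaxMod (G : StocGame) (lam : ℝ) (s0 : G.S) (i : G.I)
    (Di : Finset (Finset G.S)) (c : Finset G.S → ℝ) : ℝ :=
  ⨅ σ : G.Profile, ⨆ σi : G.BStrat i,
    modPayoff lam s0 (Function.update σ i σi) i Di c

/-- The max-min value of player `i` in the modified game. -/
def maxminMod (G : StocGame) (lam : ℝ) (s0 : G.S) (i : G.I)
    (Di : Finset (Finset G.S)) (c : Finset G.S → ℝ) : ℝ :=
  ⨆ σi : G.BStrat i, ⨅ σ : G.Profile,
    modPayoff lam s0 (Function.update σ i σi) i Di c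

/-- The min-max value in stationary strategies of player `i` in the modified game. -/
def minmaxModStat (G : StocGame) (lam : ℝ) (s0 : G.S) (i : G.I)
    (Di : Finset (Finset G.S)) (c : Finset G.S → ℝ) : ℝ :=
  ⨅ x : G.StatProf, ⨆ xi : G.Stat i,
    modPayoff lam s0 (Function.update (toB x) i (toB1 xi)) i Di c

/-- The max-min value in stationary strategies of player `i` in the modified game. -/
def maxminModStat (G : StocGame) (lam : ℝ) (s0 : G.S) (i : G.I)
    (Di : Finset (Finset G.S)) (c : Finset G.S → ℝ) : ℝ :=
  ⨆ xi : G.Stat i, ⨅ x : G.StatProf,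
    modPayoff lam s0 (Function.update (toB x) i (toB1 xi)) i Di c

/-! ### Plays and the induced measure -/

/-- A play: the infinite sequence of (state, action profile) pairs. -/
abbrev Play (G : StocGame) : Type := ℕ → G.Step

instance : MeasurableSpace G.Step := ⊤

/-- The finite history consisting of the first `n` stages of the play `p`
(reversed list of the first `n` steps, together with the state at stage `n`). -/
def histOf (p : G.Play) : ℕ → G.Hist
  | 0 => ([], (p 0).1)
  | n + 1 => ((p n) :: (histOf p n).1, (p (n + 1)).1)

/-- The cylinder set of plays whose initial segment is the finite history `h`. -/
def cylSet (h : G.Hist) : Set G.Play := {p | histOf p h.1.length = h}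

/-- `μfam` is the family of probability measures on plays induced (via the
Ionescu–Tulcea theorem) by the initial state and the strategy profile:
it is characterized by being a probability measure giving each cylinder set
the probability of the corresponding finite history. -/
def IsInduced (μfam : G.S → G.Profile → Measure G.Play) : Prop :=
  (∀ s0 σ, IsProbabilityMeasure (μfam s0 σ)) ∧
  ∀ (s0 : G.S) (σ : G.Profile) (h : G.Hist),
    μfam s0 σ (cylSet h) = ENNReal.ofReal (probHist s0 σ h)

/-- A bounded stopping time (with respect to the filtration generated by finite histories). -/
def IsBddST (τ : G.Play → ℕ) : Prop :=
  (∃ B, ∀ p, τ p ≤ B) ∧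
  ∀ p p' n, τ p = n → histOf p n = histOf p' n → τ p' = n

/-- Two states lie in the same element of the partition `Di`. -/
def sameOf (Di : Finset (Finset G.S)) (s s' : G.S) : Prop := ∃ D ∈ Di, s ∈ D ∧ s' ∈ D

open Classical in
/-- The number of switches between elements of a partition along a play,
where the partition is described through the relation `r` ("being in the same element"). -/
def Zsw (r : G.S → G.S → Prop) (p : G.Play) : ℝ≥0∞ :=
  ∑' n : ℕ, if r (p n).1 (p (n + 1)).1 then 0 else 1

/-- The stopping times `τ^𝒟_k` indicating when the play moves from one element of
the partition (described by the relation `r`) to another. -/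
def switchT (r : G.S → G.S → Prop) (p : G.Play) : ℕ → ℕ∞
  | 0 => 0
  | k + 1 => sInf {n : ℕ∞ | ∃ m : ℕ, n = (m : ℕ∞) ∧ switchT r p k < (m : ℕ∞) ∧
      ¬ r (p (m - 1)).1 (p m).1}

/-- The expected average payoff of player `i` in the `N`-stage game. -/
def payoffN (μfam : G.S → G.Profile → Measure G.Play) (N : ℕ) (s0 : G.S)
    (σ : G.Profile) (i : G.I) : ℝ :=
  (∫ p, (∑ n ∈ Finset.range N, G.u i (p n).1 (p n).2) ∂(μfam s0 σ)) / N

/-- `σi` is a uniform `ε`-max-min strategy of player `i` (with respect to the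
uniform max-min value function `v`). -/
def UnifMaxMin (μfam : G.S → G.Profile → Measure G.Play) (v : G.S → ℝ) (i : G.I)
    (σi : G.BStrat i) (ε : ℝ) : Prop :=
  ∃ lam0 : ℝ, 0 ≤ lam0 ∧ lam0 < 1 ∧ ∃ N0 : ℕ,
    ∀ (s0 : G.S) (σ : G.Profile),
      (∀ lam : ℝ, lam0 < lam → lam < 1 →
        v s0 - ε ≤ payoffD lam s0 (Function.update σ i σi) i) ∧
      (∀ τ : G.Play → ℕ, IsBddST τ →
        (N0 : ℝ) ≤ ∫ p, (τ p : ℝ) ∂(μfam s0 (Function.update σ i σi)) →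
        (v s0 - ε) * ∫ p, (τ p : ℝ) ∂(μfam s0 (Function.update σ i σi)) ≤
          ∫ p, (∑ n ∈ Finset.range (τ p), G.u i (p n).1 (p n).2)
            ∂(μfam s0 (Function.update σ i σi)))

/-- `σi` is `(𝒟,ε)`-max-min preserving, where the partition `𝒟` is described by the
relation `r`, and the conditional-expectation requirement is expressed through
integrals over the atoms (cylinder sets) of the σ-algebra of the stopping time `τ^𝒟_k`. -/
def PreservingPart (μfam : G.S → G.Profile → Measure G.Play) (v : G.S → ℝ)
    (r : G.S → G.S → Prop) (i : G.I) (σi : G.BStrat i) (ε : ℝ) : Prop :=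
  ∀ (s0 : G.S) (σ : G.Profile) (k : ℕ) (τ' : G.Play → ℕ), IsBddST τ' →
    (∀ p, switchT r p k ≠ ⊤ →
      switchT r p k < (τ' p : ℕ∞) ∧ (τ' p : ℕ∞) ≤ switchT r p (k + 1)) →
    ∀ h : G.Hist, (∀ p ∈ cylSet h, switchT r p k = (h.1.length : ℕ∞)) →
      ∫ p in cylSet h, (v h.2 - ε) ∂(μfam s0 (Function.update σ i σi)) ≤
        ∫ p in cylSet h, v ((p (τ' p)).1) ∂(μfam s0 (Function.update σ i σi))

/-- `σi` is `ε`-max-min preserving (with respect to arbitrary bounded stopping times);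
again the conditional-expectation requirement is expressed through integrals over the
atoms of the σ-algebra of the stopping time `τ`. -/
def PreservingST (μfam : G.S → G.Profile → Measure G.Play) (v : G.S → ℝ) (i : G.I)
    (σi : G.BStrat i) (ε : ℝ) : Prop :=
  ∀ (s0 : G.S) (σ : G.Profile) (τ τ' : G.Play → ℕ), IsBddST τ → IsBddST τ' →
    (∀ p, τ p < τ' p) →
    ∀ h : G.Hist, (∀ p ∈ cylSet h, τ p = h.1.length) →
      ∫ p in cylSet h, (v h.2 - ε) ∂(μfam s0 (Function.update σ i σi)) ≤
        ∫ p in cylSet h, v ((p (τ' p)).1) ∂(μfam s0 (Function.update σ i σi))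

/-- A history enters a new element of the partition (described by `r`) at its final stage. -/
def entersNew (r : G.S → G.S → Prop) (h : G.Hist) : Prop :=
  match h.1 with
  | [] => True
  | st :: _ => ¬ r st.1 h.2

/-- `σi` is `𝒟`-Markovian: its continuation strategy coincides after any two finite histories
that end at the same state and whose final stage enters a new element of the partition
(described by `r`). -/
def Markovian (r : G.S → G.S → Prop) {i : G.I} (σi : G.BStrat i) : Prop :=
  ∀ h h' : G.Hist, h.2 = h'.2 → entersNew r h → entersNew r h' →
    ∀ (l : List G.Step) (s'' : G.S), σi (l ++ h.1, s'') = σi (l ++ h'.1, s'')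

open Classical in
/-- The portion of the history since the last time the play entered a new element of the
partition (described by `r`): (reversed) list of steps, given the current state. -/
def philist (r : G.S → G.S → Prop) : List G.Step → G.S → List G.Step
  | [], _ => []
  | st :: rest, s => if r st.1 s then st :: philist r rest st.1 else []

/-- The restart strategy `σ^i_𝒟`: whenever the play enters a new element of the partition
(described by `r`), player `i` forgets past play and restarts playing `σi`. -/
def restart {i : G.I} (σi : G.BStrat i) (r : G.S → G.S → Prop) : G.BStrat i :=
  fun h => σi (philist r h.1 h.2, h.2)

/-- The partition `Di` satisfies Property P with respect to player `i`
(whose uniform max-min value function is `v`). -/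
def PropertyP (μfam : G.S → G.Profile → Measure G.Play) (v : G.S → ℝ) (i : G.I)
    (Di : Finset (Finset G.S)) : Prop :=
  ∃ ζ : ℝ, 0 < ζ ∧ ∀ ε : ℝ, 0 < ε → ∃ σi : G.BStrat i,
    Markovian (sameOf Di) σi ∧ UnifMaxMin μfam v i σi ε ∧
    ∀ (s0 : G.S) (σ : G.Profile), ∃ E : Set G.Play,
      ENNReal.ofReal (1 - ε) < μfam s0 (Function.update σ i σi) E ∧
      ∫⁻ p in E, Zsw (sameOf Di) p ∂(μfam s0 (Function.update σ i σi)) ≤ ENNReal.ofReal ζ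

/-- The strategy profile `σ` (whose `i`-th coordinate is the strategy of player `i`) makes
player `i`'s strategy a uniform `𝒟`-subgame-perfect `ε`-min-max strategy against the others'
strategies, at the initial state `s0`; `vbar` is the uniform min-max value function of
player `i`, and the partition `𝒟` is described by the relation `r`.  Conditional-expectation
requirements are expressed through integrals over the atoms (cylinder sets) of the σ-algebra
of the stopping time `τ^𝒟_k`. -/
def SubgamePerfect (μfam : G.S → G.Profile → Measure G.Play) (vbar : G.S → ℝ)
    (r : G.S → G.S → Prop) (i : G.I) (σ : G.Profile) (s0 : G.S) (ε : ℝ) : Prop :=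
  ∃ N0 : ℕ, 0 < N0 ∧
    (∀ N : ℕ, N0 ≤ N → vbar s0 - ε ≤ payoffN μfam N s0 σ i) ∧
    (∀ (k : ℕ) (τ : G.Play → ℕ), IsBddST τ → (∀ p, switchT r p k ≤ (τ p : ℕ∞)) →
      ∀ h : G.Hist, (∀ p ∈ cylSet h, switchT r p k = (h.1.length : ℕ∞)) →
        (∫ p in cylSet h, (vbar h.2 - ε) ∂(μfam s0 σ) ≤
          ∫ p in cylSet h, vbar ((p (τ p)).1) ∂(μfam s0 σ)) ∧
        ((N0 : ℝ) * (μfam s0 σ (cylSet h)).toReal ≤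
            ∫ p in cylSet h, ((τ p : ℝ) - (h.1.length : ℝ)) ∂(μfam s0 σ) →
          (vbar h.2 - ε) * ∫ p in cylSet h, ((τ p : ℝ) - (h.1.length : ℝ)) ∂(μfam s0 σ) ≤
            ∫ p in cylSet h, (∑ n ∈ Finset.Ico h.1.length (τ p), G.u i (p n).1 (p n).2)
              ∂(μfam s0 σ)))

/-- The partition `Di` satisfies Property P' with respect to player `i`
(whose uniform min-max value function is `vbar`). -/
def PropertyP' (μfam : G.S → G.Profile → Measure G.Play) (vbar : G.S → ℝ) (i : G.I)
    (Di : Finset (Finset G.S)) : Prop :=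
  ∃ ζ : ℝ, 0 < ζ ∧ ∀ ε : ℝ, 0 < ε → ∀ (s0 : G.S) (σ : G.Profile), ∃ σi : G.BStrat i,
    SubgamePerfect μfam vbar (sameOf Di) i (Function.update σ i σi) s0 ε ∧
    ∃ E : Set G.Play,
      ENNReal.ofReal (1 - ε) ≤ μfam s0 (Function.update σ i σi) E ∧
      ∫⁻ p in E, Zsw (sameOf Di) p ∂(μfam s0 (Function.update σ i σi)) ≤ ENNReal.ofReal ζ

/-! ### Reachability, closed and strongly controllable sets -/

/-- The first arrival time to the set of states `C`. -/
def hitT (C : Set G.S) (p : G.Play) : ℕ∞ :=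
  sInf {n : ℕ∞ | ∃ m : ℕ, n = (m : ℕ∞) ∧ (p m).1 ∈ C}

/-- State `s` leads in `D` to state `s'`. -/
def LeadsIn (μfam : G.S → G.Profile → Measure G.Play) (D : Set G.S) (s s' : G.S) : Prop :=
  ∃ σ : G.Profile, μfam s σ {p | hitT {s'} p < hitT Dᶜ p} = 1

/-- The states `s` and `s'` are `D`-siblings. -/
def Siblings (μfam : G.S → G.Profile → Measure G.Play) (D : Set G.S) (s s' : G.S) : Prop :=
  LeadsIn μfam D s s' ∧ LeadsIn μfam D s' s

/-- The probability `q(D | s, a)` that the next state lies in `D`. -/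
def qOf (D : Set G.S) (s : G.S) (a : G.Prof s) : ℝ := ∑ s', D.indicator (G.q s a) s'

/-- The set of states `D` is closed. -/
def ClosedSet (G : StocGame) (D : Set G.S) : Prop :=
  ∀ s ∈ D, ∀ a : G.Prof s, qOf D s a = 1

/-- The set of states `D` is strongly controllable. -/
def StronglyContr (G : StocGame) (D : Set G.S) : Prop :=
  ∃ iD : G.I, ∃ sD ∈ D, ∃ atil : G.A iD sD,
    ∀ s ∈ D, ∀ a : G.Prof s, qOf D s a < 1 → s = sD ∧ HEq (a iD) atil

/-- The element of the partition `𝒟` (by the vector of uniform min-max values `v`)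
that contains the state `s`. -/
def Dv (v : G.I → G.S → ℝ) (s : G.S) : Set G.S := {s' | ∀ i, v i s' = v i s}

/-- The element of the refined partition `𝒟*` (refining `𝒟` by the `D`-siblings relation)
that contains the state `s`. -/
def DstarCl (μfam : G.S → G.Profile → Measure G.Play) (v : G.I → G.S → ℝ) (s : G.S) :
    Set G.S := {s' | s' ∈ Dv v s ∧ Siblings μfam (Dv v s) s s'}

/-- The stochastic game is strongly controllable: every element of `𝒟*` is either closed
or strongly controllable. -/
def StronglyControllableGame (G : StocGame) (μfam : G.S → G.Profile → Measure G.Play)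
    (v : G.I → G.S → ℝ) : Prop :=
  ∀ s : G.S, ClosedSet G (DstarCl μfam v s) ∨ StronglyContr G (DstarCl μfam v s)

end StocGame

/-- A set `X ⊆ ℝ^ι` is monovex if every two points of `X` are connected by a continuous
path inside `X` all of whose coordinates are monotone. -/
def Monovex {ι : Type} (X : Set (ι → ℝ)) : Prop :=
  ∀ x ∈ X, ∀ y ∈ X, ∃ f : ℝ → ι → ℝ,
    ContinuousOn f (Set.Icc 0 1) ∧ (∀ t ∈ Set.Icc (0 : ℝ) 1, f t ∈ X) ∧
    f 0 = x ∧ f 1 = y ∧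
    ∀ j : ι, MonotoneOn (fun t => f t j) (Set.Icc 0 1) ∨
      AntitoneOn (fun t => f t j) (Set.Icc 0 1)

end

section Brouwer

open Metric Polynomial

theorem exists_polynomial_eval_eq_det_one_add_smul {E : Type*} [NormedAddCommGroup E]
    [NormedSpace ℝ E] [FiniteDimensional ℝ E] (A : E →L[ℝ] E) :
    ∃ p : ℝ[X], p.natDegree ≤ Module.finrank ℝ E ∧
      ∀ t : ℝ, p.eval t = (1 + t • A : E →L[ℝ] E).det := by
  classical
  let b := Module.finBasis ℝ E
  let M := LinearMap.toMatrix b b (A : E →ₗ[ℝ] E)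
  refine ⟨Matrix.det ((X : ℝ[X]) • M.map C + (1 : Matrix _ _ ℝ).map C), ?_, fun t => ?_⟩
  · simpa using Polynomial.natDegree_det_X_add_C_le M 1
  · rw [← Polynomial.coe_evalRingHom, RingHom.map_det]
    change _ = LinearMap.det ((1 + t • A : E →L[ℝ] E) : E →ₗ[ℝ] E)
    rw [← LinearMap.det_toMatrix b]
    congr 1
    have : (((1 + t • A : E →L[ℝ] E)) : E →ₗ[ℝ] E) = 1 + t • (A : E →ₗ[ℝ] E) := rfl
    rw [this, map_add (LinearMap.toMatrix b b), map_smul (LinearMap.toMatrix b b),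
      LinearMap.toMatrix_one]
    ext i j
    simp [M, Matrix.one_apply, add_comm, mul_comm t, apply_ite]

/-- Determinants of the pencil `1 + t • A` at `t = 1` are a fixed affine combination of its
determinants at any sufficiently large set of nodes. -/
theorem exists_weights_det_one_add {E : Type*} [NormedAddCommGroup E]
    [NormedSpace ℝ E] [FiniteDimensional ℝ E] (v : Fin (Module.finrank ℝ E + 1) → ℝ)
    (hv : Function.Injective v) :
    ∃ w : Fin (Module.finrank ℝ E + 1) → ℝ, ∑ k, w k = 1 ∧
      ∀ A : E →L[ℝ] E, (1 + A).det = ∑ k, w k * (1 + v k • A : E →L[ℝ] E).det := by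
  have key : ∀ p : ℝ[X], p.natDegree ≤ Module.finrank ℝ E →
      p.eval 1 = ∑ k, (Lagrange.basis Finset.univ v k).eval 1 * p.eval (v k) := by
    intro p hp
    have h := Lagrange.eq_interpolate (s := Finset.univ) (v := v) (f := p) hv.injOn (by
      refine (Polynomial.degree_le_natDegree).trans_lt ?_
      rw [Finset.card_univ, Fintype.card_fin]
      exact_mod_cast Nat.lt_succ_of_le hp)
    conv_lhs => rw [h]
    simp [Lagrange.interpolate_apply, Polynomial.eval_finsetSum, mul_comm]
  refine ⟨fun k => (Lagrange.basis Finset.univ v k).eval 1, ?_, fun A => ?_⟩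
  · simpa using (key 1 (by simp)).symm
  · obtain ⟨p, hp, h⟩ := exists_polynomial_eval_eq_det_one_add_smul A
    have := key p hp
    simpa only [h, one_smul] using this

variable {E : Type*} [NormedAddCommGroup E] [InnerProductSpace ℝ E] [FiniteDimensional ℝ E]

theorem exists_lipschitz_of_zero_on_sphere {g : E → E} (hg : ContDiff ℝ 1 g) {R : ℝ}
    (hR : 0 < R) (h0 : ∀ x, ‖x‖ = R → g x = 0) :
    ∃ K : ℝ, 0 < K ∧ (∀ x ∈ closedBall (0 : E) R, ‖fderiv ℝ g x‖ ≤ K) ∧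
      ∀ x y, ‖(ball (0 : E) R).indicator g x - (ball (0 : E) R).indicator g y‖
        ≤ K * ‖x - y‖ := by
  obtain ⟨K, hK⟩ := (isCompact_closedBall (0 : E) R).exists_bound_of_continuousOn
    (hg.continuous_fderiv one_ne_zero).continuousOn
  have hK' : ∀ x ∈ closedBall (0 : E) R, ‖fderiv ℝ g x‖ ≤ max K 1 :=
    fun x hx => (hK x hx).trans (le_max_left _ _)
  have hlip : ∀ x ∈ closedBall (0 : E) R, ∀ y ∈ closedBall (0 : E) R,
      ‖g x - g y‖ ≤ max K 1 * ‖x - y‖ := fun x hx y hy =>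
    (convex_closedBall (0 : E) R).norm_image_sub_le_of_norm_fderiv_le
      (fun z _ => hg.differentiable one_ne_zero z) hK' hy hx
  have hmix : ∀ x ∈ ball (0 : E) R, ∀ y ∉ ball (0 : E) R, ‖g x‖ ≤ max K 1 * ‖x - y‖ := by
    intro x hx y hy
    rw [mem_ball_zero_iff] at hx hy
    push Not at hy
    suffices ∃ z, ‖z‖ = R ∧ ‖x - z‖ ≤ ‖x - y‖ by
      obtain ⟨z, hz, hxz⟩ := this
      have := hlip x (by simpa using hx.le) z (by simpa using hz.le)
      rw [h0 z hz, sub_zero] at this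
      exact this.trans (by gcongr)
    rcases eq_or_ne x 0 with rfl | hx0
    · have hy0 : 0 < ‖y‖ := hR.trans_le hy
      refine ⟨(R / ‖y‖) • y, ?_, ?_⟩
      · rw [norm_smul, Real.norm_of_nonneg (by positivity)]; field_simp
      · rw [zero_sub, zero_sub, norm_neg, norm_neg, norm_smul,
          Real.norm_of_nonneg (by positivity)]
        field_simp; exact hy
    · have hx0 : 0 < ‖x‖ := norm_pos_iff.2 hx0
      refine ⟨(R / ‖x‖) • x, ?_, ?_⟩
      · rw [norm_smul, Real.norm_of_nonneg (by positivity)]; field_simp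
      · have : x - (R / ‖x‖) • x = -((R / ‖x‖ - 1) • x) := by module
        rw [this, norm_neg, norm_smul, Real.norm_of_nonneg, sub_mul, div_mul_cancel₀ _ hx0.ne']
        · have := norm_sub_norm_le y x
          rw [norm_sub_rev] at this
          linarith
        · rw [sub_nonneg, one_le_div hx0]; exact hx.le
  refine ⟨max K 1, by positivity, hK', fun x y => ?_⟩
  by_cases hx : x ∈ ball (0 : E) R <;> by_cases hy : y ∈ ball (0 : E) R
  · simpa [hx, hy] using hlip x (ball_subset_closedBall hx) y (ball_subset_closedBall hy)
  · simpa [hx, hy] using hmix x hx y hy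
  · simpa [hx, hy, norm_sub_rev] using hmix y hy x hx
  · simp only [Set.indicator_of_notMem hx, Set.indicator_of_notMem hy, sub_self, norm_zero]
    positivity

variable [MeasurableSpace E] [BorelSpace E]

theorem integral_det_one_add_fderiv_eq {g : E → E} (hg : ContDiff ℝ 1 g) {R : ℝ}
    (hR : 0 < R) (h0 : ∀ x, ‖x‖ = R → g x = 0) :
    ∫ x in ball (0 : E) R, (1 + fderiv ℝ g x).det = volume.real (ball (0 : E) R) := by
  obtain ⟨K, hK0, hK, hlip⟩ := exists_lipschitz_of_zero_on_sphere hg hR h0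
  obtain ⟨η, hη, hdet⟩ : ∃ η > 0, ∀ B : E →L[ℝ] E, ‖B‖ < η → 0 < (1 + B).det := by
    have hc : ContinuousAt (fun B : E →L[ℝ] E => (1 + B).det) 0 :=
      (ContinuousLinearMap.continuous_det.comp (continuous_const.add continuous_id)).continuousAt
    have := hc.eventually (lt_mem_nhds (a := 0) (by simp [ContinuousLinearMap.det]))
    obtain ⟨η, hη, h⟩ := Metric.eventually_nhds_iff.1 this
    exact ⟨η, hη, fun B hB => h (by simpa using hB)⟩
  have hcont : ∀ t : ℝ, Continuous fun x => (1 + t • fderiv ℝ g x : E →L[ℝ] E).det := fun t =>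
    ContinuousLinearMap.continuous_det.comp
      (continuous_const.add ((hg.continuous_fderiv one_ne_zero).const_smul t))
  have hintg : ∀ t : ℝ, IntegrableOn (fun x => (1 + t • fderiv ℝ g x : E →L[ℝ] E).det)
      (ball (0 : E) R) := fun t =>
    ((hcont t).continuousOn.integrableOn_compact (isCompact_closedBall 0 R)).mono_set
      ball_subset_closedBall
  have small : ∀ t : ℝ, 0 < t → t * K < 1 → t * K < η →
      ∫ x in ball (0 : E) R, (1 + t • fderiv ℝ g x : E →L[ℝ] E).det
        = volume.real (ball (0 : E) R) := by
    intro t ht ht1 htη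
    set F : E → E := fun x => x + t • (ball (0 : E) R).indicator g x with hF
    have hout : ∀ x, x ∉ ball (0 : E) R → F x = x := fun x hx => by simp [hF, hx]
    have happ : ApproximatesLinearOn F ((ContinuousLinearEquiv.refl ℝ E : E ≃L[ℝ] E) : E →L[ℝ] E)
        Set.univ ⟨t * K, by positivity⟩ := by
      intro x _ y _
      have : F x - F y - (x - y) =
          t • ((ball (0 : E) R).indicator g x - (ball (0 : E) R).indicator g y) := by
        simp only [hF]; module
      simp only [ContinuousLinearEquiv.coe_refl, ContinuousLinearMap.coe_id', id]
      rw [this, norm_smul, Real.norm_of_nonneg ht.le]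
      change _ ≤ t * K * _
      rw [mul_assoc]
      exact mul_le_mul_of_nonneg_left (hlip x y) ht.le
    have hN : Subsingleton E ∨ (⟨t * K, by positivity⟩ : NNReal) <
        ‖((ContinuousLinearEquiv.refl ℝ E).symm : E →L[ℝ] E)‖₊⁻¹ := by
      rcases subsingleton_or_nontrivial E with h | h
      · exact Or.inl h
      · right
        have : ‖((ContinuousLinearEquiv.refl ℝ E).symm : E →L[ℝ] E)‖₊ = 1 := by
          ext; simp
        rw [this, inv_one]
        exact ht1
    have hinj : Function.Injective F := Set.injOn_univ.1 (happ.injOn hN)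
    have hsurj : Function.Surjective F := happ.surjective hN
    have himg : F '' ball (0 : E) R = ball (0 : E) R := by
      apply Set.Subset.antisymm
      · rintro _ ⟨x, hx, rfl⟩
        by_contra h
        have := hinj (hout _ h)
        exact h (by rwa [this])
      · intro y hy
        obtain ⟨x, rfl⟩ := hsurj y
        refine ⟨x, ?_, rfl⟩
        by_contra h
        rw [hout x h] at hy
        exact h hy
    have hder : ∀ x ∈ ball (0 : E) R, HasFDerivWithinAt F (1 + t • fderiv ℝ g x : E →L[ℝ] E)
        (ball (0 : E) R) x := by
      intro x hx
      have h1 : HasFDerivAt (fun x => x + t • g x) (1 + t • fderiv ℝ g x : E →L[ℝ] E) x :=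
        (hasFDerivAt_id x).add ((hg.differentiable one_ne_zero x).hasFDerivAt.const_smul t)
      exact h1.hasFDerivWithinAt.congr (fun y hy => by simp [hF, hy]) (by simp [hF, hx])
    have hpos : ∀ x ∈ ball (0 : E) R, 0 < (1 + t • fderiv ℝ g x : E →L[ℝ] E).det := by
      intro x hx
      apply hdet
      rw [norm_smul, Real.norm_of_nonneg ht.le]
      exact (mul_le_mul_of_nonneg_left (hK x (ball_subset_closedBall hx)) ht.le).trans_lt htη
    have hvol := lintegral_abs_det_fderiv_eq_addHaar_image volume measurableSet_ball hder
      hinj.injOn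
    rw [himg] at hvol
    rw [integral_eq_lintegral_of_nonneg_ae _ (hintg t).aestronglyMeasurable, measureReal_def,
      ← hvol]
    · congr 1
      exact setLIntegral_congr_fun measurableSet_ball fun x hx => by
        simp only [abs_of_pos (hpos x hx)]
    · exact (ae_restrict_iff' measurableSet_ball).2 (ae_of_all _ fun x hx => (hpos x hx).le)
  let δ : ℝ := min 1 η / (2 * K)
  have hδ : 0 < δ := by positivity
  have hδK : δ * K < min 1 η := by
    have : 0 < min 1 η := by positivity
    have : δ * K = min 1 η / 2 := by simp only [δ]; field_simp
    linarith
  let v : Fin (Module.finrank ℝ E + 1) → ℝ := fun k => δ / (k + 1)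
  have hv : Function.Injective v := by
    intro a b hab
    have ha : (0 : ℝ) < (a : ℝ) + 1 := by positivity
    have hb : (0 : ℝ) < (b : ℝ) + 1 := by positivity
    simp only [v] at hab
    rw [div_eq_div_iff ha.ne' hb.ne'] at hab
    have := mul_left_cancel₀ hδ.ne' hab
    ext
    exact_mod_cast (add_right_cancel this).symm
  have hvpos : ∀ k, 0 < v k := fun k => by simp only [v]; positivity
  have hvle : ∀ k, v k * K < min 1 η := fun k => by
    refine lt_of_le_of_lt ?_ hδK
    gcongr
    exact div_le_self hδ.le (by simp)
  obtain ⟨w, hw1, hw⟩ := exists_weights_det_one_add v hv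
  rw [funext fun x => hw (fderiv ℝ g x)]
  rw [integral_finsetSum _ fun k _ => (hintg (v k)).const_mul (w k)]
  simp_rw [integral_const_mul]
  rw [Finset.sum_congr rfl fun k _ => by
    rw [small (v k) (hvpos k) ((hvle k).trans_le (min_le_left _ _))
      ((hvle k).trans_le (min_le_right _ _))], ← Finset.sum_mul, hw1, one_mul]

theorem exists_fixedPoint_of_contDiff {f : E → E} (hf : ContDiff ℝ 1 f) {R : ℝ} (hR : 0 < R)
    (h0 : ∀ x, ‖x‖ = R → f x = 0) : ∃ x, f x = x := by
  by_contra! hne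
  have hh : ∀ x, x - f x ≠ 0 := fun x hx => hne x (sub_eq_zero.1 hx).symm
  let r : E → E := fun x => (R / ‖x - f x‖) • (x - f x)
  have hsub : ContDiff ℝ 1 fun x => x - f x := contDiff_id.sub hf
  have hr : ContDiff ℝ 1 r :=
    (contDiff_const.div (hsub.norm ℝ hh) fun x => norm_ne_zero_iff.2 (hh x)).smul hsub
  have hrn : ∀ x, ‖r x‖ = R := fun x => by
    have := norm_pos_iff.2 (hh x)
    simp only [r]
    rw [norm_smul, Real.norm_of_nonneg (by positivity)]; field_simp
  have hdet := integral_det_one_add_fderiv_eq (g := fun x => r x - x) (hr.sub contDiff_id) hR (by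
    intro x hx
    simp [r, h0 x hx, hx, hR.ne'])
  have hzero : ∀ x, (1 + fderiv ℝ (fun x => r x - x) x).det = 0 := by
    intro x
    have hd := (hr.differentiable one_ne_zero x).hasFDerivAt
    have h1 : fderiv ℝ (fun x => r x - x) x = fderiv ℝ r x - 1 := (hd.sub (hasFDerivAt_id x)).fderiv
    rw [h1, add_sub_cancel]
    by_contra hdet
    have hsurj : Function.Surjective (fderiv ℝ r x) :=
      ((LinearMap.equivOfDetNeZero (fderiv ℝ r x : E →ₗ[ℝ] E) hdet)).surjective
    obtain ⟨v, hv⟩ := hsurj (r x)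
    have h2 : HasFDerivAt (fun y => ‖r y‖ ^ 2) _ x := hd.norm_sq
    have h3 : (fun y => ‖r y‖ ^ 2) = fun _ => R ^ 2 := by funext y; rw [hrn]
    rw [h3] at h2
    have h4 := congrArg (fun L : E →L[ℝ] ℝ => L v) (h2.unique (hasFDerivAt_const _ x))
    simp [hv, hrn] at h4
    exact hR.ne' h4
  simp only [hzero, integral_zero] at hdet
  have : 0 < volume.real (ball (0 : E) R) :=
    ENNReal.toReal_pos (measure_ball_pos _ _ hR).ne' measure_ball_lt_top.ne
  exact this.ne hdet

theorem exists_fixedPoint_of_bounded_of_inner {f : E → E} (hf : Continuous f) {M : ℝ}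
    (hM : ∀ x, ‖f x‖ ≤ M) : ∃ x, f x = x := by
  have hM0 : 0 ≤ M := (norm_nonneg _).trans (hM 0)
  let c : E → ℝ := fun x => max 0 (min 1 (M + 1 - ‖x‖))
  have hc0 : ∀ x, 0 ≤ c x := fun x => le_max_left _ _
  have hc1 : ∀ x, c x ≤ 1 := fun x => max_le zero_le_one (min_le_left _ _)
  let F : E → E := fun x => c x • f x
  have hF : Continuous F := by
    have : Continuous c := by fun_prop
    exact this.smul hf
  have hFout : ∀ x, M + 1 ≤ ‖x‖ → F x = 0 := fun x hx => by
    have : c x = 0 := max_eq_left ((min_le_right _ _).trans (by linarith))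
    simp [F, this]
  obtain ⟨x, -, hx⟩ := (isCompact_closedBall (0 : E) (M + 1)).exists_isMinOn
    (nonempty_closedBall.2 (by linarith)) (continuous_id.dist hF).continuousOn
  have hxF : F x = x := by
    rw [eq_comm, ← dist_le_zero]
    refine le_of_forall_pos_le_add fun ε hε => ?_
    obtain ⟨g, hg, hgF, hsupp⟩ := hF.exists_contDiff_approx 1 (ε := fun _ => ε)
      continuous_const fun _ => hε
    have hgout : ∀ y, M + 1 ≤ ‖y‖ → g y = 0 := fun y hy => by
      by_contra h
      exact hsupp h (hFout y hy)
    obtain ⟨y, hy⟩ := exists_fixedPoint_of_contDiff hg (R := M + 1) (by linarith)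
      fun y hy => hgout y hy.ge
    have hyR : ‖y‖ ≤ M + 1 := by
      by_contra! h
      rw [hgout y h.le] at hy
      rw [← hy, norm_zero] at h
      linarith
    have h1 : dist x (F x) ≤ dist y (F y) := hx (mem_closedBall_zero_iff.2 hyR)
    have h2 := hgF y
    rw [hy] at h2
    linarith
  have hxM : ‖x‖ ≤ M := by
    rw [← hxF, norm_smul, Real.norm_of_nonneg (hc0 x)]
    exact (mul_le_of_le_one_left (norm_nonneg _) (hc1 x)).trans (hM x)
  have : c x = 1 := by
    simp only [c]
    rw [min_eq_left (by linarith), max_eq_right zero_le_one]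
  refine ⟨x, ?_⟩
  simpa [F, this] using hxF

/-- Brouwer's fixed point theorem, for bounded continuous self-maps of a finite-dimensional
normed space. -/
theorem exists_fixedPoint_of_bounded {E : Type*} [NormedAddCommGroup E] [NormedSpace ℝ E]
    [FiniteDimensional ℝ E] {f : E → E} (hf : Continuous f) {M : ℝ} (hM : ∀ x, ‖f x‖ ≤ M) :
    ∃ x, f x = x := by
  let e : E ≃L[ℝ] EuclideanSpace ℝ (Fin (Module.finrank ℝ E)) := toEuclidean
  obtain ⟨x, hx⟩ := exists_fixedPoint_of_bounded_of_inner (f := fun x => e (f (e.symm x)))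
    (M := ‖(e : E →L[ℝ] EuclideanSpace ℝ (Fin (Module.finrank ℝ E)))‖ * M)
    (by fun_prop) fun x =>
      ((e : E →L[ℝ] EuclideanSpace ℝ (Fin (Module.finrank ℝ E))).le_opNorm (f (e.symm x))).trans
        (mul_le_mul_of_nonneg_left (hM _) (norm_nonneg _))
  exact ⟨e.symm x, e.injective (by rw [hx, e.apply_symm_apply])⟩

end Brouwer

namespace StocGame

variable {G : StocGame}

section Occupation

theorem sum_prod_mixed (s : G.S) (ξ : (j : G.I) → Mixed (G.A j s)) :
    ∑ a : G.Prof s, ∏ j, (ξ j).1 (a j) = 1 := by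
  have h := Finset.prod_univ_sum (fun j : G.I => (Finset.univ : Finset (G.A j s)))
    (fun j b => (ξ j).1 b)
  rw [Fintype.piFinset_univ] at h
  rw [← h]
  exact Finset.prod_eq_one fun j _ => (ξ j).2.2

theorem prod_mixed_nonneg {s : G.S} (ξ : (j : G.I) → Mixed (G.A j s)) (a : G.Prof s) :
    0 ≤ ∏ j, (ξ j).1 (a j) := Finset.prod_nonneg fun j _ => (ξ j).2.1 _

theorem probHistAux_nonneg (s0 : G.S) (σ : G.Profile) (l : List G.Step) (s : G.S) :
    0 ≤ probHistAux s0 σ l s := by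
  induction l generalizing s with
  | nil => unfold probHistAux; split_ifs <;> simp
  | cons st l ih =>
    exact mul_nonneg (mul_nonneg (ih _) (prod_mixed_nonneg _ _)) (G.q_nonneg _ _ _)

/-- The discounted weight of the history `(l, s)`. -/
def histWeight (lam : ℝ) (s0 : G.S) (σ : G.Profile) (l : List G.Step) (s : G.S) : ℝ :=
  lam ^ l.length * probHistAux s0 σ l s

/-- The discounted weight of the history `(l, st.1)` followed by the action profile `st.2`. -/
def stepWeight (lam : ℝ) (s0 : G.S) (σ : G.Profile) (st : G.Step) (l : List G.Step) : ℝ :=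
  histWeight lam s0 σ l st.1 * ∏ j, (σ j (l, st.1)).1 (st.2 j)

variable {lam : ℝ} (s0 : G.S) (σ : G.Profile)

theorem histWeight_nonneg (hlam0 : 0 ≤ lam) (l : List G.Step) (s : G.S) :
    0 ≤ histWeight lam s0 σ l s :=
  mul_nonneg (pow_nonneg hlam0 _) (probHistAux_nonneg _ _ _ _)

theorem stepWeight_nonneg (hlam0 : 0 ≤ lam) (st : G.Step) (l : List G.Step) :
    0 ≤ stepWeight lam s0 σ st l :=
  mul_nonneg (histWeight_nonneg s0 σ hlam0 _ _) (prod_mixed_nonneg _ _)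

theorem histWeight_nil (s : G.S) : histWeight lam s0 σ [] s = if s = s0 then 1 else 0 := by
  simp [histWeight, probHistAux]

theorem histWeight_cons (st : G.Step) (l : List G.Step) (s : G.S) :
    histWeight lam s0 σ (st :: l) s = lam * (stepWeight lam s0 σ st l * G.q st.1 st.2 s) := by
  simp only [histWeight, stepWeight, probHistAux, List.length_cons, pow_succ]
  ring

theorem sum_stepWeight_mul (l : List G.Step) (V : G.S → ℝ) :
    ∑ st, stepWeight lam s0 σ st l * V st.1 = ∑ s, histWeight lam s0 σ l s * V s := by
  rw [Fintype.sum_sigma]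
  refine Finset.sum_congr rfl fun s _ => ?_
  simp only [stepWeight]
  rw [← Finset.sum_mul, ← Finset.mul_sum, sum_prod_mixed s fun j => σ j (l, s), mul_one]

/-- Prepending an element to a list, as an embedding. -/
def consEmbedding (α : Type) : α × List α ↪ List α :=
  ⟨fun p => p.1 :: p.2, fun _ _ h => Prod.ext (List.cons.inj h).1 (List.cons.inj h).2⟩

@[simp]
theorem consEmbedding_apply {α : Type} (p : α × List α) : consEmbedding α p = p.1 :: p.2 := rfl

/-- The finite set of lists of length less than `n`. -/
def shortLists (α : Type) [Fintype α] : ℕ → Finset (List α)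
  | 0 => ∅
  | n + 1 => Finset.cons [] ((Finset.univ ×ˢ shortLists α n).map (consEmbedding α)) (by simp)

theorem mem_shortLists {α : Type} [Fintype α] {n : ℕ} {l : List α} (h : l.length < n) :
    l ∈ shortLists α n := by
  induction n generalizing l with
  | zero => omega
  | succ n ih =>
    cases l with
    | nil => simp [shortLists]
    | cons a l =>
      exact Finset.mem_cons.2 (Or.inr (Finset.mem_map.2
        ⟨(a, l), by simp [ih (Nat.lt_of_succ_lt_succ h)], rfl⟩))

theorem sum_shortLists_histWeight_le (hlam0 : 0 ≤ lam) (hlam1 : lam < 1) (n : ℕ) :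
    ∑ l ∈ shortLists G.Step n, ∑ s, histWeight lam s0 σ l s ≤ (1 - lam)⁻¹ := by
  have hpos : 0 < 1 - lam := by linarith
  induction n with
  | zero => simpa [shortLists] using hpos.le
  | succ n ih =>
    simp only [shortLists, Finset.sum_cons, Finset.sum_map, consEmbedding_apply,
      histWeight_nil, histWeight_cons, Finset.sum_ite_eq', Finset.mem_univ, if_true,
      ← Finset.mul_sum, G.q_sum, mul_one, Finset.sum_product_right]
    have h : ∀ l, ∑ st, stepWeight lam s0 σ st l = ∑ s, histWeight lam s0 σ l s := fun l => by
      simpa using sum_stepWeight_mul (lam := lam) s0 σ l fun _ => 1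
    simp only [h]
    calc 1 + lam * ∑ l ∈ shortLists G.Step n, ∑ s, histWeight lam s0 σ l s
        ≤ 1 + lam * (1 - lam)⁻¹ := by gcongr
      _ = (1 - lam)⁻¹ := by field_simp; ring

theorem summable_histWeight (hlam0 : 0 ≤ lam) (hlam1 : lam < 1) (s : G.S) :
    Summable fun l => histWeight lam s0 σ l s := by
  have h : Summable fun l => ∑ s, histWeight lam s0 σ l s := by
    refine summable_of_sum_le (c := (1 - lam)⁻¹)
      (fun l => Finset.sum_nonneg fun s _ => histWeight_nonneg s0 σ hlam0 l s) fun t => ?_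
    refine (Finset.sum_le_sum_of_subset_of_nonneg
      (t := shortLists G.Step (t.sup List.length + 1)) (fun l hl => mem_shortLists ?_)
      fun l _ _ => Finset.sum_nonneg fun s _ => histWeight_nonneg s0 σ hlam0 l s).trans
      (sum_shortLists_histWeight_le s0 σ hlam0 hlam1 _)
    exact Nat.lt_succ_of_le (Finset.le_sup (f := List.length) hl)
  exact h.of_nonneg_of_le (fun l => histWeight_nonneg s0 σ hlam0 l s) fun l =>
    Finset.single_le_sum (f := fun s => histWeight lam s0 σ l s)
      (fun s _ => histWeight_nonneg s0 σ hlam0 l s) (Finset.mem_univ s)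

theorem summable_stepWeight (hlam0 : 0 ≤ lam) (hlam1 : lam < 1) (st : G.Step) :
    Summable fun l => stepWeight lam s0 σ st l :=
  (summable_histWeight s0 σ hlam0 hlam1 st.1).of_nonneg_of_le
    (fun l => stepWeight_nonneg s0 σ hlam0 st l) fun l =>
    mul_le_of_le_one_right (histWeight_nonneg s0 σ hlam0 l st.1)
      (Finset.prod_le_one (fun j _ => (σ j (l, st.1)).2.1 _) fun j _ =>
        (Finset.single_le_sum (f := fun b => (σ j (l, st.1)).1 b)
          (fun b _ => (σ j (l, st.1)).2.1 b) (Finset.mem_univ _)).trans_eq (σ j (l, st.1)).2.2)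

theorem tStep_eq_tsum_stepWeight (hlam0 : 0 ≤ lam) (hlam1 : lam < 1) (st : G.Step) :
    tStep lam s0 σ st = (1 - lam) * ∑' l, stepWeight lam s0 σ st l := by
  unfold tStep
  congr 1
  have hinj : Function.Injective fun h : G.Hist => ((st :: h.1, h.2) : G.Hist) := by
    intro h h' e
    simp only [Prod.mk.injEq, List.cons.injEq, true_and] at e
    exact Prod.ext e.1 e.2
  rw [← hinj.tsum_eq]
  · have h1 : ∀ h : G.Hist, (if ((st :: h.1, h.2) : G.Hist).1.head? = some st then
        lam ^ (((st :: h.1, h.2) : G.Hist).1.length - 1) * probHist s0 σ (st :: h.1, h.2) else 0)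
        = stepWeight lam s0 σ st h.1 * G.q st.1 st.2 h.2 := fun h => by
      simp only [List.head?_cons, if_true, List.length_cons, Nat.add_sub_cancel, probHist,
        probHistAux, stepWeight, histWeight]
      ring
    rw [tsum_congr h1]
    have hsum := summable_stepWeight s0 σ hlam0 hlam1 st
    have hq : Summable fun s => G.q st.1 st.2 s := (hasSum_fintype _).summable
    have := hsum.tsum_mul_tsum hq (hsum.mul_of_nonneg hq
      (fun l => stepWeight_nonneg s0 σ hlam0 st l) fun s => G.q_nonneg _ _ _)
    rw [← this, tsum_fintype fun s => G.q st.1 st.2 s, G.q_sum, mul_one]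
  · rintro ⟨l, s⟩ h
    cases l with
    | nil => simp at h
    | cons st' l =>
      simp only [Function.mem_support, List.head?_cons, Option.some.injEq, ne_eq,
        ite_eq_right_iff, Classical.not_imp] at h
      exact ⟨(l, s), by rw [h.1]⟩

theorem sum_tStep_mul_eq_tsum (hlam0 : 0 ≤ lam) (hlam1 : lam < 1) (R : G.Step → ℝ) :
    ∑ st, tStep lam s0 σ st * R st = (1 - lam) * ∑' l, ∑ st, stepWeight lam s0 σ st l * R st := by
  rw [Summable.tsum_finsetSum fun st _ => (summable_stepWeight s0 σ hlam0 hlam1 st).mul_right _,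
    Finset.mul_sum]
  refine Finset.sum_congr rfl fun st _ => ?_
  rw [tStep_eq_tsum_stepWeight s0 σ hlam0 hlam1, tsum_mul_right, mul_assoc]

/-- The balance equation of discounted occupation times, tested against a function of the
state. -/
theorem sum_tStep_balance (hlam0 : 0 ≤ lam) (hlam1 : lam < 1) (V : G.S → ℝ) :
    ∑ st, tStep lam s0 σ st * V st.1 = (1 - lam) * V s0 +
      lam * ∑ st, tStep lam s0 σ st * ∑ s, G.q st.1 st.2 s * V s := by
  rw [sum_tStep_mul_eq_tsum s0 σ hlam0 hlam1 fun st => V st.1]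
  simp_rw [sum_stepWeight_mul]
  have hsum : Summable fun l => ∑ s, histWeight lam s0 σ l s * V s :=
    summable_sum fun s _ => (summable_histWeight s0 σ hlam0 hlam1 s).mul_right _
  have hinj : Function.Injective fun p : G.Step × List G.Step => p.1 :: p.2 := by
    intro p p' e
    simp only [List.cons.injEq] at e
    exact Prod.ext e.1 e.2
  classical
  rw [hsum.tsum_eq_add_tsum_ite [], ← hinj.tsum_eq (f := fun l => if l = [] then 0 else _)]
  · have h1 : ∀ p : G.Step × List G.Step, (if p.1 :: p.2 = [] then 0 else
        ∑ s, histWeight lam s0 σ (p.1 :: p.2) s * V s) =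
        lam * (stepWeight lam s0 σ p.1 p.2 * ∑ s, G.q p.1.1 p.1.2 s * V s) := fun p => by
      simp only [reduceCtorEq, if_false, histWeight_cons, Finset.mul_sum]
      exact Finset.sum_congr rfl fun s _ => by ring
    have hsum2 := hsum.comp_injective hinj
    simp only [Function.comp_def] at hsum2
    have h2 : ∀ p : G.Step × List G.Step, ∑ s, histWeight lam s0 σ (p.1 :: p.2) s * V s =
        lam * (stepWeight lam s0 σ p.1 p.2 * ∑ s, G.q p.1.1 p.1.2 s * V s) := fun p => by
      rw [← h1 p, if_neg (by simp)]
    rw [funext h2] at hsum2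
    rw [tsum_congr h1, hsum2.tsum_prod, tsum_fintype]
    simp only [histWeight_nil, ite_mul, one_mul, zero_mul, Finset.sum_ite_eq', Finset.mem_univ,
      if_true, tsum_mul_left, tsum_mul_right, tStep_eq_tsum_stepWeight s0 σ hlam0 hlam1]
    rw [mul_add, Finset.mul_sum, Finset.mul_sum]
    congr 1
    exact Finset.sum_congr rfl fun st _ => by ring
  · intro l hl
    cases l with
    | nil => simp at hl
    | cons st l => exact ⟨(st, l), rfl⟩

/-- Verification: a superharmonic function bounds the discounted reward. -/
theorem sum_tStep_mul_le (hlam0 : 0 ≤ lam) (hlam1 : lam < 1) (ρ : G.Step → ℝ) (V : G.S → ℝ)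
    (h : ∀ l s, ∑ a : G.Prof s, (∏ j, (σ j (l, s)).1 (a j)) *
      (ρ ⟨s, a⟩ + lam * ∑ s', G.q s a s' * V s') ≤ V s) :
    ∑ st, tStep lam s0 σ st * ρ st ≤ (1 - lam) * V s0 := by
  have key : ∑ st, tStep lam s0 σ st *
      (ρ st + lam * ∑ s', G.q st.1 st.2 s' * V s' - V st.1) ≤ 0 := by
    rw [sum_tStep_mul_eq_tsum s0 σ hlam0 hlam1]
    refine mul_nonpos_of_nonneg_of_nonpos (by linarith) (tsum_nonpos fun l => ?_)
    rw [Fintype.sum_sigma]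
    refine Finset.sum_nonpos fun s _ => ?_
    simp only [stepWeight, mul_assoc]
    rw [← Finset.mul_sum]
    refine mul_nonpos_of_nonneg_of_nonpos (histWeight_nonneg s0 σ hlam0 l s) ?_
    simp only [mul_sub]
    rw [Finset.sum_sub_distrib, ← Finset.sum_mul, sum_prod_mixed s fun j => σ j (l, s), one_mul]
    linarith [h l s]
  have hb := sum_tStep_balance s0 σ hlam0 hlam1 V
  have hexp : ∑ st, tStep lam s0 σ st *
      (ρ st + lam * ∑ s', G.q st.1 st.2 s' * V s' - V st.1) =
      ∑ st, tStep lam s0 σ st * ρ st +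
        lam * ∑ st, tStep lam s0 σ st * ∑ s', G.q st.1 st.2 s' * V s' -
        ∑ st, tStep lam s0 σ st * V st.1 := by
    rw [Finset.mul_sum, ← Finset.sum_add_distrib, ← Finset.sum_sub_distrib]
    exact Finset.sum_congr rfl fun st _ => by ring
  linarith

theorem sum_tStep_mul_eq (hlam0 : 0 ≤ lam) (hlam1 : lam < 1) (ρ : G.Step → ℝ) (V : G.S → ℝ)
    (h : ∀ l s, ∑ a : G.Prof s, (∏ j, (σ j (l, s)).1 (a j)) *
      (ρ ⟨s, a⟩ + lam * ∑ s', G.q s a s' * V s') = V s) :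
    ∑ st, tStep lam s0 σ st * ρ st = (1 - lam) * V s0 := by
  refine le_antisymm (sum_tStep_mul_le s0 σ hlam0 hlam1 ρ V fun l s => (h l s).le) ?_
  have := sum_tStep_mul_le s0 σ hlam0 hlam1 (fun st => -ρ st) (fun s => -V s) fun l s => by
    rw [← h l s, ← Finset.sum_neg_distrib]
    refine (Finset.sum_congr rfl fun a _ => ?_).le
    simp only [mul_neg, Finset.sum_neg_distrib]
    ring
  simp only [mul_neg, Finset.sum_neg_distrib] at this
  linarith

end Occupation

section Simplex

variable {α : Type} [Fintype α]

/-- A nonnegative vector with positive sum, equal to `y` when `y` is a probability vector. -/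
def simplexRaw (y : α → ℝ) (a : α) : ℝ := max (y a) 0 + max (1 - ∑ b, max (y b) 0) 0

/-- A continuous retraction onto the probability vectors. -/
noncomputable def toSimplex (y : α → ℝ) (a : α) : ℝ := simplexRaw y a / ∑ b, simplexRaw y b

theorem simplexRaw_nonneg (y : α → ℝ) (a : α) : 0 ≤ simplexRaw y a :=
  add_nonneg (le_max_right _ _) (le_max_right _ _)

theorem one_le_sum_simplexRaw [Nonempty α] (y : α → ℝ) : 1 ≤ ∑ b, simplexRaw y b := by
  obtain ⟨a⟩ := ‹Nonempty α›
  have h : max (1 - ∑ b, max (y b) 0) 0 ≤ ∑ _b : α, max (1 - ∑ b, max (y b) 0) 0 :=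
    Finset.single_le_sum (f := fun _ : α => max (1 - ∑ b, max (y b) 0) 0)
      (fun _ _ => le_max_right _ _) (Finset.mem_univ a)
  have h' := le_max_left (1 - ∑ b, max (y b) 0) 0
  simp only [simplexRaw, Finset.sum_add_distrib]
  linarith

theorem toSimplex_nonneg (y : α → ℝ) (a : α) : 0 ≤ toSimplex y a :=
  div_nonneg (simplexRaw_nonneg y a) (Finset.sum_nonneg fun b _ => simplexRaw_nonneg y b)

theorem sum_toSimplex [Nonempty α] (y : α → ℝ) : ∑ a, toSimplex y a = 1 := by
  simp only [toSimplex]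
  rw [← Finset.sum_div, div_self (by linarith [one_le_sum_simplexRaw y])]

theorem continuous_toSimplex [Nonempty α] (a : α) : Continuous fun y : α → ℝ => toSimplex y a := by
  refine Continuous.div ?_ ?_ fun y => by linarith [one_le_sum_simplexRaw y]
  · unfold simplexRaw; fun_prop
  · unfold simplexRaw; fun_prop

theorem toSimplex_eq_self {y : α → ℝ} (h0 : ∀ a, 0 ≤ y a) (h1 : ∑ a, y a = 1) (a : α) :
    toSimplex y a = y a := by
  simp [toSimplex, simplexRaw, h0, h1]

/-- The Nash map: it moves probability towards actions better than average. -/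
noncomputable def nashMap (x Q : α → ℝ) (b : α) : ℝ :=
  (x b + max (Q b - ∑ a, x a * Q a) 0) / (1 + ∑ c, max (Q c - ∑ a, x a * Q a) 0)

theorem one_le_nashMap_den (x Q : α → ℝ) : 1 ≤ 1 + ∑ c, max (Q c - ∑ a, x a * Q a) 0 :=
  le_add_of_nonneg_right (Finset.sum_nonneg fun _ _ => le_max_right _ _)

theorem nashMap_nonneg {x : α → ℝ} (hx : ∀ a, 0 ≤ x a) (Q : α → ℝ) (b : α) :
    0 ≤ nashMap x Q b :=
  div_nonneg (add_nonneg (hx b) (le_max_right _ _)) (by linarith [one_le_nashMap_den x Q])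

theorem sum_nashMap {x : α → ℝ} (hx : ∑ a, x a = 1) (Q : α → ℝ) : ∑ b, nashMap x Q b = 1 := by
  simp only [nashMap]
  rw [← Finset.sum_div, Finset.sum_add_distrib, hx,
    div_self (by linarith [one_le_nashMap_den x Q])]

theorem le_of_nashMap_eq {x Q : α → ℝ} (hx : ∑ a, x a = 1) (h : ∀ b, nashMap x Q b = x b) (b : α) :
    Q b ≤ ∑ a, x a * Q a := by
  set v := ∑ a, x a * Q a with hv
  set g : α → ℝ := fun c => max (Q c - v) 0 with hg
  have hxg : ∀ c, x c * ∑ c, g c = g c := fun c => by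
    have h1 := h c
    rw [nashMap, div_eq_iff (by linarith [one_le_nashMap_den x Q])] at h1
    change x c + g c = x c * (1 + ∑ c, g c) at h1
    linarith
  have hsq : ∑ c, g c * g c = 0 := by
    have h2 : ∀ c, g c * g c = (∑ c, g c) * (x c * Q c - x c * v) := fun c => by
      have : g c * g c = g c * (Q c - v) := by
        rcases le_total (Q c - v) 0 with h3 | h3
        · simp [hg, h3]
        · simp [hg, h3]
      rw [this]
      nth_rewrite 1 [← hxg c]
      ring
    simp only [h2]
    rw [← Finset.mul_sum, Finset.sum_sub_distrib, ← Finset.sum_mul, hx, ← hv, one_mul, sub_self,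
      mul_zero]
  have h3 := (Finset.sum_eq_zero_iff_of_nonneg fun c _ => mul_self_nonneg (g c)).1 hsq b
    (Finset.mem_univ b)
  have h4 : g b = 0 := mul_self_eq_zero.1 h3
  have h5 : Q b - v ≤ g b := le_max_left _ _
  linarith

end Simplex

section Bellman

/-- The expected value of `R` at state `s` when the players mix according to `p`. -/
def meanValue {s : G.S} (p : (j : G.I) → G.A j s → ℝ) (R : G.Prof s → ℝ) : ℝ :=
  ∑ a : G.Prof s, (∏ j, p j (a j)) * R a

/-- The expected value of `R` when player `i` plays `b` and the others mix according to `p`. -/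
def actionValue {s : G.S} (i : G.I) (p : (j : G.I) → G.A j s → ℝ) (R : G.Prof s → ℝ)
    (b : G.A i s) : ℝ :=
  ∑ a : G.Prof s, if a i = b then (∏ j ∈ Finset.univ.erase i, p j (a j)) * R a else 0

theorem meanValue_eq_sum_actionValue {s : G.S} (i : G.I) {p p' : (j : G.I) → G.A j s → ℝ}
    (h : ∀ j, j ≠ i → p' j = p j) (R : G.Prof s → ℝ) :
    meanValue p' R = ∑ b, p' i b * actionValue i p R b := by
  simp only [actionValue, Finset.mul_sum, mul_ite, mul_zero]
  rw [Finset.sum_comm]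
  refine Finset.sum_congr rfl fun a _ => ?_
  rw [Finset.sum_ite_eq Finset.univ (a i), if_pos (Finset.mem_univ _),
    ← Finset.mul_prod_erase Finset.univ _ (Finset.mem_univ i), mul_assoc]
  congr 2
  exact Finset.prod_congr rfl fun j hj => by rw [h j (Finset.ne_of_mem_erase hj)]

theorem abs_meanValue_le {s : G.S} {p : (j : G.I) → G.A j s → ℝ} (h0 : ∀ j b, 0 ≤ p j b)
    (h1 : ∀ j, ∑ b, p j b = 1) {R : G.Prof s → ℝ} {C : ℝ} (hR : ∀ a, |R a| ≤ C) :
    |meanValue p R| ≤ C := by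
  calc |meanValue p R| ≤ ∑ a : G.Prof s, (∏ j, p j (a j)) * C := by
        refine (Finset.abs_sum_le_sum_abs _ _).trans (Finset.sum_le_sum fun a _ => ?_)
        have : 0 ≤ ∏ j, p j (a j) := Finset.prod_nonneg fun j _ => h0 j _
        rw [abs_mul, abs_of_nonneg this]
        exact mul_le_mul_of_nonneg_left (hR a) this
    _ = C := by
        rw [← Finset.sum_mul, sum_prod_mixed s fun j => ⟨p j, h0 j, h1 j⟩, one_mul]

/-- The one-step discounted return. -/
def stepReturn (lam : ℝ) (ρ : G.Step → ℝ) (V : G.S → ℝ) (s : G.S) (a : G.Prof s) : ℝ :=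
  ρ ⟨s, a⟩ + lam * ∑ s', G.q s a s' * V s'

theorem abs_stepReturn_le {lam : ℝ} (hlam0 : 0 ≤ lam) {ρ : G.Step → ℝ} {V : G.S → ℝ} {B M : ℝ}
    (hρ : ∀ st, |ρ st| ≤ B) (hV : ∀ s, |V s| ≤ M) (s : G.S) (a : G.Prof s) :
    |stepReturn lam ρ V s a| ≤ B + lam * M := by
  refine (abs_add_le _ _).trans (add_le_add (hρ _) ?_)
  rw [abs_mul, abs_of_nonneg hlam0]
  refine mul_le_mul_of_nonneg_left ?_ hlam0
  calc |∑ s', G.q s a s' * V s'| ≤ ∑ s', G.q s a s' * M := by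
        refine (Finset.abs_sum_le_sum_abs _ _).trans (Finset.sum_le_sum fun s' _ => ?_)
        rw [abs_mul, abs_of_nonneg (G.q_nonneg s a s')]
        exact mul_le_mul_of_nonneg_left (hV s') (G.q_nonneg s a s')
    _ = M := by rw [← Finset.sum_mul, G.q_sum, one_mul]

/-- Truncation of a real number to `[-M, M]`. -/
def clamp (M v : ℝ) : ℝ := max (-M) (min M v)

theorem abs_clamp_le {M : ℝ} (hM : 0 ≤ M) (v : ℝ) : |clamp M v| ≤ M :=
  abs_le.2 ⟨le_max_left _ _, max_le (by linarith) (min_le_left _ _)⟩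

theorem clamp_eq_self {M v : ℝ} (h : |v| ≤ M) : clamp M v = v := by
  rw [clamp, min_eq_right (abs_le.1 h).2, max_eq_right (abs_le.1 h).1]

/-- Truncation of a real number to `[0, 1]`. -/
def unitClamp (v : ℝ) : ℝ := max 0 (min 1 v)

theorem unitClamp_nonneg (v : ℝ) : 0 ≤ unitClamp v := le_max_left _ _

theorem unitClamp_le_one (v : ℝ) : unitClamp v ≤ 1 := max_le zero_le_one (min_le_left _ _)

theorem unitClamp_eq_self {v : ℝ} (h0 : 0 ≤ v) (h1 : v ≤ 1) : unitClamp v = v := by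
  rw [unitClamp, min_eq_right h1, max_eq_right h0]

theorem eq_zero_of_unitClamp_sub {w d : ℝ} (h : unitClamp (w - d) = w) (hd : 0 < d) : w = 0 := by
  rcases max_choice 0 (min 1 (w - d)) with h1 | h1
  · rw [← h]; exact h1
  · have : min 1 (w - d) ≤ w - d := min_le_right _ _
    rw [unitClamp, h1] at h
    linarith

theorem eq_one_of_unitClamp_sub {w d : ℝ} (h : unitClamp (w - d) = w) (hd : d < 0) : w = 1 := by
  rcases min_choice 1 (w - d) with h1 | h1
  · rw [unitClamp, h1, max_eq_right zero_le_one] at h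
    exact h.symm
  · have : w - d ≤ max 0 (w - d) := le_max_right _ _
    rw [unitClamp, h1] at h
    linarith

/-- The space of candidate profiles, values, auxiliary values and weights. -/
abbrev SystemSpace (G : StocGame) : Type :=
  ((i : G.I) → (s : G.S) → G.A i s → ℝ) × (G.I → G.S → ℝ) ×
    (G.I → Finset G.S → G.S → ℝ) × (G.I → Finset G.S → ℝ)

/-- Existence of a stationary profile and of endogenous weights `w` such that the profile is an
equilibrium of the discounted game with rewards `r w`, and each `w i D` is a best reply to the
discounted value `W i D` of the reward `ρ i D`. -/
theorem exists_stationary_system (G : StocGame) (s0 : G.S) {lam : ℝ} (hlam0 : 0 ≤ lam)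
    (hlam1 : lam < 1) (r : (G.I → Finset G.S → ℝ) → G.I → G.Step → ℝ)
    (ρ : G.I → Finset G.S → G.Step → ℝ) {B : ℝ} (hr : ∀ i st, Continuous fun w => r w i st)
    (hrB : ∀ w, (∀ i D, 0 ≤ w i D ∧ w i D ≤ 1) → ∀ i st, |r w i st| ≤ B)
    (hρB : ∀ i D st, |ρ i D st| ≤ B) (hB : 0 ≤ B) :
    ∃ (x : G.StatProf) (V : G.I → G.S → ℝ) (W : G.I → Finset G.S → G.S → ℝ)
      (w : G.I → Finset G.S → ℝ), (∀ i D, 0 ≤ w i D ∧ w i D ≤ 1) ∧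
      (∀ i s, meanValue (fun j => (x j s).1) (stepReturn lam (r w i) (V i) s) = V i s) ∧
      (∀ i s b,
        actionValue i (fun j => (x j s).1) (stepReturn lam (r w i) (V i) s) b ≤ V i s) ∧
      (∀ i D s, meanValue (fun j => (x j s).1) (stepReturn lam (ρ i D) (W i D) s) = W i D s) ∧
      (∀ i D, 0 < W i D s0 → w i D = 0) ∧ (∀ i D, W i D s0 < 0 → w i D = 1) := by
  set M := B / (1 - lam) with hM
  have hpos : 0 < 1 - lam := by linarith
  have hM0 : 0 ≤ M := div_nonneg hB hpos.le
  have hBM : B + lam * M = M := by rw [hM]; field_simp; ring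
  let x : G.SystemSpace → (s : G.S) → (i : G.I) → G.A i s → ℝ := fun z s i => toSimplex (z.1 i s)
  let w : G.SystemSpace → G.I → Finset G.S → ℝ := fun z i D => unitClamp (z.2.2.2 i D)
  let RV : G.SystemSpace → G.I → (s : G.S) → G.Prof s → ℝ := fun z i =>
    stepReturn lam (r (w z) i) fun s => clamp M (z.2.1 i s)
  let RW : G.SystemSpace → G.I → Finset G.S → (s : G.S) → G.Prof s → ℝ := fun z i D =>
    stepReturn lam (ρ i D) fun s => clamp M (z.2.2.1 i D s)
  let F : G.SystemSpace → G.SystemSpace := fun z =>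
    (fun i s => nashMap (x z s i) (actionValue i (x z s) (RV z i s)),
      fun i s => meanValue (x z s) (RV z i s),
      fun i D s => meanValue (x z s) (RW z i D s),
      fun i D => unitClamp (w z i D - clamp M (z.2.2.1 i D s0)))
  have hx0 : ∀ z s i b, 0 ≤ x z s i b := fun z s i b => toSimplex_nonneg _ _
  have hx1 : ∀ z s i, ∑ b, x z s i b = 1 := fun z s i => sum_toSimplex _
  have hVM : ∀ z i s, |meanValue (x z s) (RV z i s)| ≤ M := fun z i s =>
    abs_meanValue_le (hx0 z s) (hx1 z s) fun a => hBM ▸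
      abs_stepReturn_le hlam0 (hrB _ (fun i D => ⟨unitClamp_nonneg _, unitClamp_le_one _⟩) i)
        (fun s => abs_clamp_le hM0 _) s a
  have hWM : ∀ z i D s, |meanValue (x z s) (RW z i D s)| ≤ M := fun z i D s =>
    abs_meanValue_le (hx0 z s) (hx1 z s) fun a => hBM ▸
      abs_stepReturn_le hlam0 (hρB i D) (fun s => abs_clamp_le hM0 _) s a
  have hcx : ∀ s i b, Continuous fun z => x z s i b := fun s i b =>
    (continuous_toSimplex b).comp (by fun_prop)
  have hcw : Continuous w := by
    refine continuous_pi fun i => continuous_pi fun D => ?_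
    simp only [w, unitClamp]
    fun_prop
  have hcRV : ∀ i s a, Continuous fun z => RV z i s a := fun i s a => by
    simp only [RV, stepReturn, clamp]
    exact ((hr i _).comp hcw).add (by fun_prop)
  have hcRW : ∀ i D s a, Continuous fun z => RW z i D s a := fun i D s a => by
    simp only [RW, stepReturn, clamp]
    fun_prop
  have hcQ : ∀ i s b, Continuous fun z => actionValue i (x z s) (RV z i s) b := fun i s b => by
    refine continuous_finsetSum _ fun a _ => ?_
    split_ifs
    · exact (continuous_finsetProd _ fun j _ => hcx s j _).mul (hcRV i s a)
    · exact continuous_const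
  have hF : Continuous F := by
    refine .prodMk ?_ (.prodMk ?_ (.prodMk ?_ ?_))
    · refine continuous_pi fun i => continuous_pi fun s => continuous_pi fun b => ?_
      have hg : ∀ c, Continuous fun z => max (actionValue i (x z s) (RV z i s) c -
          ∑ a, x z s i a * actionValue i (x z s) (RV z i s) a) 0 := fun c =>
        ((hcQ i s c).sub (continuous_finsetSum _ fun a _ => (hcx s i a).mul (hcQ i s a))).max
          continuous_const
      exact ((hcx s i b).add (hg b)).div (continuous_const.add
        (continuous_finsetSum _ fun c _ => hg c)) fun z => by
          linarith [one_le_nashMap_den (x z s i) (actionValue i (x z s) (RV z i s))]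
    · exact continuous_pi fun i => continuous_pi fun s => continuous_finsetSum _ fun a _ =>
        (continuous_finsetProd _ fun j _ => hcx s j _).mul (hcRV i s a)
    · exact continuous_pi fun i => continuous_pi fun D => continuous_pi fun s =>
        continuous_finsetSum _ fun a _ =>
          (continuous_finsetProd _ fun j _ => hcx s j _).mul (hcRW i D s a)
    · refine continuous_pi fun i => continuous_pi fun D => ?_
      simp only [w, unitClamp, clamp]
      fun_prop
  have hn0 : ∀ z i s b, 0 ≤ (F z).1 i s b := fun z i s b => nashMap_nonneg (hx0 z s i) _ b
  have hn1 : ∀ z i s, ∑ b, (F z).1 i s b = 1 := fun z i s => sum_nashMap (hx1 z s i) _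
  have hbd : ∀ z, ‖F z‖ ≤ 1 + M := fun z => by
    have h1M : 0 ≤ 1 + M := by linarith
    simp only [norm_prod_le_iff, pi_norm_le_iff_of_nonneg h1M, Real.norm_eq_abs]
    refine ⟨fun i s b => ?_, fun i s => ?_, fun i D s => ?_, fun i D => ?_⟩
    · rw [abs_of_nonneg (hn0 z i s b)]
      linarith [Finset.single_le_sum (f := fun b => (F z).1 i s b) (fun b _ => hn0 z i s b)
        (Finset.mem_univ b), hn1 z i s]
    · exact (hVM z i s).trans (by linarith)
    · exact (hWM z i D s).trans (by linarith)
    · rw [abs_of_nonneg (unitClamp_nonneg _)]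
      linarith [unitClamp_le_one (w z i D - clamp M (z.2.2.1 i D s0))]
  obtain ⟨z, hz⟩ := exists_fixedPoint_of_bounded hF hbd
  have hz1 : ∀ i s b, (F z).1 i s b = z.1 i s b := fun i s b => by rw [hz]
  have hzV : ∀ i s, meanValue (x z s) (RV z i s) = z.2.1 i s := fun i s =>
    congrFun (congrFun (congrArg (fun z => z.2.1) hz) i) s
  have hzW : ∀ i D s, meanValue (x z s) (RW z i D s) = z.2.2.1 i D s := fun i D s =>
    congrFun (congrFun (congrFun (congrArg (fun z => z.2.2.1) hz) i) D) s
  have hzw : ∀ i D, unitClamp (w z i D - clamp M (z.2.2.1 i D s0)) = z.2.2.2 i D := fun i D =>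
    congrFun (congrFun (congrArg (fun z => z.2.2.2) hz) i) D
  have hxz : ∀ i s b, x z s i b = z.1 i s b := fun i s b =>
    toSimplex_eq_self (fun b => by rw [← hz1]; exact hn0 z i s b)
      (by simp only [← hz1]; exact hn1 z i s) b
  have hwz : ∀ i D, w z i D = z.2.2.2 i D := fun i D =>
    unitClamp_eq_self (by rw [← hzw]; exact unitClamp_nonneg _)
      (by rw [← hzw]; exact unitClamp_le_one _)
  have hcV : ∀ i s, clamp M (z.2.1 i s) = z.2.1 i s := fun i s =>
    clamp_eq_self (by rw [← hzV]; exact hVM z i s)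
  have hcW : ∀ i D s, clamp M (z.2.2.1 i D s) = z.2.2.1 i D s := fun i D s =>
    clamp_eq_self (by rw [← hzW]; exact hWM z i D s)
  have hRV : ∀ i, RV z i = stepReturn lam (r (w z) i) (z.2.1 i) := fun i => by
    simp only [RV, hcV]
  have hRW : ∀ i D, RW z i D = stepReturn lam (ρ i D) (z.2.2.1 i D) := fun i D => by
    simp only [RW, hcW]
  refine ⟨fun i s => ⟨x z s i, hx0 z s i, hx1 z s i⟩, z.2.1, z.2.2.1, w z,
    fun i D => ⟨unitClamp_nonneg _, unitClamp_le_one _⟩, fun i s => ?_, fun i s b => ?_,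
    fun i D s => ?_, fun i D h => ?_, fun i D h => ?_⟩
  · rw [← hRV]; exact hzV i s
  · rw [← hRV, ← hzV, meanValue_eq_sum_actionValue i fun _ _ => rfl]
    exact le_of_nashMap_eq (hx1 z s i) (fun b => (hz1 i s b).trans (hxz i s b).symm) b
  · rw [← hRW]; exact hzW i D s
  · exact eq_zero_of_unitClamp_sub ((hzw i D).trans (hwz i D).symm) (by rwa [hcW])
  · exact eq_one_of_unitClamp_sub ((hzw i D).trans (hwz i D).symm) (by rwa [hcW])

end Bellman

section Modified

/-- The payoff relative to the cutoff on the set `D`. -/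
def excess (i : G.I) (c : Finset G.S → ℝ) (D : Finset G.S) (st : G.Step) : ℝ :=
  if st.1 ∈ D then G.u i st.1 st.2 - c D else 0

/-- The payoff on `D`, mixed with the cutoff with weight `1 - w`. -/
def mixedReward (i : G.I) (c w : Finset G.S → ℝ) (D : Finset G.S) (st : G.Step) : ℝ :=
  if st.1 ∈ D then w D * G.u i st.1 st.2 + (1 - w D) * c D else 0

theorem abs_excess_le (i : G.I) (c : Finset G.S → ℝ) (D : Finset G.S) (st : G.Step) :
    |excess i c D st| ≤ 1 + |c D| := by
  unfold excess
  split_ifs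
  · exact (abs_sub _ _).trans (by gcongr; exact G.u_bdd _ _ _)
  · simp; positivity

theorem abs_mixedReward_le (i : G.I) (c : Finset G.S → ℝ) {w : Finset G.S → ℝ}
    {D : Finset G.S} (h0 : 0 ≤ w D) (h1 : w D ≤ 1) (st : G.Step) :
    |mixedReward i c w D st| ≤ 1 + |c D| := by
  unfold mixedReward
  split_ifs
  · refine (abs_add_le _ _).trans (add_le_add ?_ ?_)
    · rw [abs_mul, abs_of_nonneg h0]
      exact mul_le_one₀ h1 (abs_nonneg _) (G.u_bdd _ _ _)
    · rw [abs_mul, abs_of_nonneg (by linarith)]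
      exact mul_le_of_le_one_left (abs_nonneg _) (by linarith)
  · simp; positivity

variable (lam : ℝ) (s0 : G.S) (σ : G.Profile) (i : G.I) (c w : Finset G.S → ℝ)

theorem sum_tStep_mul_excess (D : Finset G.S) :
    ∑ st, tStep lam s0 σ st * excess i c D st = UD lam s0 σ i D - tSet lam s0 σ D * c D := by
  rw [UD, tSet, Finset.sum_mul, ← Finset.sum_sub_distrib]
  refine Finset.sum_congr rfl fun st _ => ?_
  unfold excess
  split_ifs <;> ring

theorem sum_tStep_mul_mixedReward (Di : Finset (Finset G.S)) :
    ∑ st, tStep lam s0 σ st * ∑ D ∈ Di, mixedReward i c w D st =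
      ∑ D ∈ Di, (w D * UD lam s0 σ i D + (1 - w D) * (tSet lam s0 σ D * c D)) := by
  simp only [Finset.mul_sum]
  rw [Finset.sum_comm]
  refine Finset.sum_congr rfl fun D _ => ?_
  rw [UD, tSet, Finset.sum_mul, Finset.mul_sum, Finset.mul_sum, ← Finset.sum_add_distrib]
  refine Finset.sum_congr rfl fun st _ => ?_
  unfold mixedReward
  split_ifs <;> ring

theorem modPayoff_le_sum (Di : Finset (Finset G.S)) (hw : ∀ D, 0 ≤ w D ∧ w D ≤ 1) :
    modPayoff lam s0 σ i Di c ≤ ∑ st, tStep lam s0 σ st * ∑ D ∈ Di, mixedReward i c w D st := by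
  rw [sum_tStep_mul_mixedReward]
  refine Finset.sum_le_sum fun D _ => ?_
  nlinarith [mul_le_mul_of_nonneg_left (min_le_left (UD lam s0 σ i D) (tSet lam s0 σ D * c D))
    (hw D).1, mul_le_mul_of_nonneg_left (min_le_right (UD lam s0 σ i D) (tSet lam s0 σ D * c D))
    (sub_nonneg.2 (hw D).2)]

theorem modPayoff_eq_sum (Di : Finset (Finset G.S))
    (h0 : ∀ D, 0 < UD lam s0 σ i D - tSet lam s0 σ D * c D → w D = 0)
    (h1 : ∀ D, UD lam s0 σ i D - tSet lam s0 σ D * c D < 0 → w D = 1) :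
    modPayoff lam s0 σ i Di c = ∑ st, tStep lam s0 σ st * ∑ D ∈ Di, mixedReward i c w D st := by
  rw [sum_tStep_mul_mixedReward]
  refine Finset.sum_congr rfl fun D _ => ?_
  rcases lt_trichotomy (UD lam s0 σ i D - tSet lam s0 σ D * c D) 0 with h | h | h
  · rw [h1 D h, min_eq_left (by linarith)]; ring
  · rw [sub_eq_zero.1 h, min_self]; ring
  · rw [h0 D h, min_eq_right (by linarith)]; ring

end Modified

end StocGame

open StocGame in
/-- the modified game admits an equilibrium in stationary strategies. -/
theorem stmt_0 (G : StocGame) (s0 : G.S) (lam : ℝ) (hlam0 : 0 ≤ lam) (hlam1 : lam < 1)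
    (Di : G.I → Finset (Finset G.S)) (hDi : ∀ i, IsPartitionF (Di i))
    (c : G.I → Finset G.S → ℝ) :
    ∃ x : G.StatProf, ∀ (i : G.I) (σi : G.BStrat i),
      modPayoff lam s0 (Function.update (toB x) i σi) i (Di i) (c i) ≤
        modPayoff lam s0 (toB x) i (Di i) (c i) := by
  have hsub : ∀ i, ∀ D, 1 + |c i D| ≤ ∑ i, ∑ D, (1 + |c i D|) := fun i D =>
    (Finset.single_le_sum (f := fun D => 1 + |c i D|) (fun D _ => by positivity)
      (Finset.mem_univ D)).trans
    (Finset.single_le_sum (f := fun i => ∑ D, (1 + |c i D|)) (fun i _ => by positivity)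
      (Finset.mem_univ i))
  obtain ⟨x, V, W, w, hw, hV, hQ, hW, hw0, hw1⟩ := exists_stationary_system G s0 hlam0 hlam1
    (fun w i st => ∑ D ∈ Di i, mixedReward i (c i) (w i) D st) (fun i => excess i (c i))
    (B := ∑ i, ∑ D, (1 + |c i D|))
    (fun i st => continuous_finsetSum _ fun D _ => by
      unfold mixedReward
      split_ifs <;> fun_prop)
    (fun w hw i st => by
      refine (Finset.abs_sum_le_sum_abs _ _).trans ((Finset.sum_le_sum fun D _ =>
        abs_mixedReward_le i (c i) (hw i D).1 (hw i D).2 st).trans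
        ((Finset.sum_le_sum_of_subset_of_nonneg (Finset.subset_univ _)
          fun D _ _ => by positivity).trans ?_))
      exact Finset.single_le_sum (f := fun i => ∑ D, (1 + |c i D|)) (fun i _ => by positivity)
        (Finset.mem_univ i))
    (fun i D st => (abs_excess_le i (c i) D st).trans (hsub i D))
    (by positivity)
  have hpos : 0 < 1 - lam := by linarith
  refine ⟨x, fun i σi => ?_⟩
  have hD : ∀ D, UD lam s0 (toB x) i D - tSet lam s0 (toB x) D * c i D =
      (1 - lam) * W i D s0 := fun D => by
    rw [← sum_tStep_mul_excess]
    exact sum_tStep_mul_eq s0 _ hlam0 hlam1 _ _ fun l s => hW i D s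
  calc _ ≤ _ := modPayoff_le_sum lam s0 _ i (c i) (w i) (Di i) (hw i)
    _ ≤ (1 - lam) * V i s0 := sum_tStep_mul_le s0 _ hlam0 hlam1 _ (V i) fun l s => ?_
    _ = _ := (sum_tStep_mul_eq s0 (toB x) hlam0 hlam1
      (fun st => ∑ D ∈ Di i, mixedReward i (c i) (w i) D st) (V i) fun l s => hV i s).symm
    _ = _ := (modPayoff_eq_sum lam s0 _ i (c i) (w i) (Di i)
      (fun D h => hw0 i D (pos_of_mul_pos_right (hD D ▸ h) hpos.le))
      (fun D h => hw1 i D (by rw [hD D] at h; exact neg_of_mul_neg_right h hpos.le))).symm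
  refine (meanValue_eq_sum_actionValue (p := fun j => (x j s).1)
    (p' := fun j => (Function.update (toB x) i σi j (l, s)).1) i (fun j hj => ?_)
    (stepReturn lam (fun st => ∑ D ∈ Di i, mixedReward i (c i) (w i) D st) (V i) s)).trans_le ?_
  · rw [Function.update_of_ne hj]; rfl
  · rw [Function.update_self]
    calc _ ≤ ∑ b, (σi (l, s)).1 b * V i s := Finset.sum_le_sum fun b _ =>
          mul_le_mul_of_nonneg_left (hQ i s b) ((σi (l, s)).2.1 b)
      _ = V i s := by rw [← Finset.sum_mul, (σi (l, s)).2.2, one_mul]
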